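/- arXiv:2105.01261 — 5 statements merged into one kernel-verified Lean document; each statement's English description precedes it below -/
import Mathlib

section
/- Let P be a probability measure on a measurable space Ω, let L : Ω → ℝ be integrable with respect to P, let β ∈ (0,1), and assume the distribution of L is atomless, i.e., P({ω : L(ω) = a}) = 0 for every a ∈ ℝ. Let α_β := inf{α ∈ ℝ : P({ω : L(ω) ≤ α}) ≥ β} and F_β(α) := α + (1−β)⁻¹ ∫ max(L − α, 0) dP. Then α_β is a minimizer of F_β, i.e., F_β(α_β) ≤ F_β(α) for all α ∈ ℝ. -/
open MeasureTheory

open Filter Topology ProbabilityTheory in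
/-- The lower `β`-quantile `a` of a real distribution satisfies `β ≤ μ (-∞, a]`
and `μ (-∞, a) ≤ β`. -/
theorem le_cdf_sInf_and_measureReal_Iio_sInf_le (μ : Measure ℝ) [IsProbabilityMeasure μ]
    {β : ℝ} (hβ : β ∈ Set.Ioo (0 : ℝ) 1) :
    β ≤ μ.real (Set.Iic (sInf {x | β ≤ cdf μ x})) ∧
      μ.real (Set.Iio (sInf {x | β ≤ cdf μ x})) ≤ β := by
  set S := {x | β ≤ cdf μ x}
  have hne : S.Nonempty :=
    (((tendsto_cdf_atTop μ).eventually (lt_mem_nhds hβ.2)).exists).imp fun _ h => h.le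
  have hbdd : BddBelow S := by
    obtain ⟨b, hb⟩ := ((tendsto_cdf_atBot μ).eventually (gt_mem_nhds hβ.1)).exists
    refine ⟨b, fun x hx => le_of_not_gt fun hxb => ?_⟩
    exact absurd (hx.trans (monotone_cdf μ hxb.le)) hb.not_ge
  constructor
  · rw [← cdf_eq_real]
    have hright : Tendsto (cdf μ) (𝓝[>] sInf S) (𝓝 (cdf μ (sInf S))) :=
      ((cdf μ).right_continuous (sInf S)).mono_left (nhdsWithin_mono _ Set.Ioi_subset_Ici_self)
    refine ge_of_tendsto hright ?_
    filter_upwards [self_mem_nhdsWithin] with x hx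
    obtain ⟨s, hs, hsx⟩ := exists_lt_of_csInf_lt hne hx
    exact le_trans hs (monotone_cdf μ hsx.le)
  · have hleft : Function.leftLim (cdf μ) (sInf S) ≤ β := by
      refine le_of_tendsto ((monotone_cdf μ).tendsto_leftLim (sInf S)) ?_
      filter_upwards [self_mem_nhdsWithin] with x hx
      exact le_of_not_ge fun h => (csInf_le hbdd h).not_gt hx
    have hIio := (cdf μ).measure_Iio (tendsto_cdf_atBot μ) (sInf S)
    rw [measure_cdf, sub_zero] at hIio
    rw [measureReal_def, hIio]
    exact ENNReal.toReal_le_of_le_ofReal hβ.1.le (ENNReal.ofReal_le_ofReal hleft)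

/-- A subgradient inequality for the expected excess `α ↦ ∫ max (y - α) 0 ∂μ` at `a`, for a
set `s` between `(a, ∞)` and `[a, ∞)`. -/
theorem integral_max_sub_add_mul_measureReal_le {μ : Measure ℝ} [IsFiniteMeasure μ]
    (hμ : Integrable id μ) {a : ℝ} (α : ℝ) {s : Set ℝ} (hs : MeasurableSet s)
    (hs_lower : Set.Ioi a ⊆ s) (hs_upper : s ⊆ Set.Ici a) :
    ∫ y, max (y - a) 0 ∂μ + (a - α) * μ.real s ≤ ∫ y, max (y - α) 0 ∂μ := by
  have hint (c : ℝ) : Integrable (fun y => max (y - c) 0) μ :=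
    (hμ.sub (integrable_const c)).pos_part
  have hind : Integrable (s.indicator fun _ => a - α) μ := (integrable_const _).indicator hs
  have hs_int : ∫ y, s.indicator (fun _ => a - α) y ∂μ = (a - α) * μ.real s := by
    rw [integral_indicator_const _ hs, smul_eq_mul, mul_comm]
  rw [← hs_int, ← integral_add (hint a) hind]
  refine integral_mono ((hint a).add hind) (hint α) fun y => ?_
  by_cases hy : y ∈ s
  · have hay : a ≤ y := hs_upper hy
    simp only [Set.indicator_of_mem hy, max_eq_left (sub_nonneg.2 hay)]
    linarith [le_max_left (y - α) 0]
  · have hya : y ≤ a := le_of_not_gt fun h => hy (hs_lower h)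
    simp [Set.indicator_of_notMem hy, hya]

theorem var_minimizes_cvar_objective {Ω : Type*} [MeasurableSpace Ω]
    (P : Measure Ω) [IsProbabilityMeasure P] (L : Ω → ℝ) (hL : Integrable L P)
    (β : ℝ) (hβ : β ∈ Set.Ioo (0 : ℝ) 1)
    (hAtomless : ∀ a : ℝ, P {ω | L ω = a} = 0)
    (αβ : ℝ) (hαβ : αβ = sInf {α : ℝ | β ≤ (P {ω | L ω ≤ α}).toReal})
    (Fβ : ℝ → ℝ)
    (hFβ : ∀ α : ℝ, Fβ α = α + (1 - β)⁻¹ * ∫ ω, max (L ω - α) 0 ∂P) :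
    ∀ α : ℝ, Fβ αβ ≤ Fβ α := by
  intro α
  have hm : AEMeasurable L P := hL.aemeasurable
  have : IsProbabilityMeasure (P.map L) := Measure.isProbabilityMeasure_map hm
  have hid : Integrable id (P.map L) :=
    (integrable_map_measure aestronglyMeasurable_id hm).2 hL
  have hF (c : ℝ) : Fβ c = c + (1 - β)⁻¹ * ∫ y, max (y - c) 0 ∂(P.map L) := by
    rw [hFβ, integral_map hm (by fun_prop)]
  have hcdf (x : ℝ) : (P {ω | L ω ≤ x}).toReal = ProbabilityTheory.cdf (P.map L) x := by
    rw [ProbabilityTheory.cdf_eq_real, measureReal_def,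
      Measure.map_apply_of_aemeasurable hm measurableSet_Iic]
    rfl
  simp only [hcdf] at hαβ
  obtain ⟨hIic, hIio⟩ := le_cdf_sInf_and_measureReal_Iio_sInf_le (P.map L) hβ
  rw [← hαβ] at hIic hIio
  have hkey : ∫ y, max (y - αβ) 0 ∂(P.map L) + (αβ - α) * (1 - β) ≤
      ∫ y, max (y - α) 0 ∂(P.map L) := by
    rcases le_total αβ α with h | h
    · have hsub := integral_max_sub_add_mul_measureReal_le hid α measurableSet_Ioi
        subset_rfl (Set.Ioi_subset_Ici_self (a := αβ))
      rw [← Set.compl_Iic, probReal_compl_eq_one_sub measurableSet_Iic] at hsub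
      nlinarith
    · have hsub := integral_max_sub_add_mul_measureReal_le hid α measurableSet_Ici
        (Set.Ioi_subset_Ici_self (a := αβ)) subset_rfl
      rw [← Set.compl_Iio, probReal_compl_eq_one_sub measurableSet_Iio] at hsub
      nlinarith
  have hpos : 0 < 1 - β := sub_pos.2 hβ.2
  have hmul := mul_le_mul_of_nonneg_left hkey (inv_nonneg.2 hpos.le)
  rw [mul_add, mul_left_comm, inv_mul_cancel₀ hpos.ne', mul_one] at hmul
  rw [hF, hF]
  linarith
end

section
/- Let P be a probability measure on a measurable space Ω, let L : Ω → ℝ be integrable with respect to P, let β ∈ (0,1), and assume the distribution of L is atomless, i.e., P({ω : L(ω) = a}) = 0 for every a ∈ ℝ. Let α_β := inf{α ∈ ℝ : P({ω : L(ω) ≤ α}) ≥ β} and F_β(α) := α + (1−β)⁻¹ ∫ max(L − α, 0) dP. Then the minimum value of F_β equals the β-CVaR: inf_{α∈ℝ} F_β(α) = F_β(α_β) = (1−β)⁻¹ ∫_{{ω : L(ω) ≥ α_β}} L dP. -/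
open MeasureTheory

/-- The distribution function of an atomless probability measure on `ℝ` is continuous. -/
lemma continuous_cdf_of_nullSingletonClass (μ : Measure ℝ) [IsProbabilityMeasure μ]
    [NullSingletonClass μ] :
    Continuous (ProbabilityTheory.cdf μ) := by
  rw [continuous_iff_continuousAt]
  intro a
  have hmono := ProbabilityTheory.monotone_cdf μ
  rw [hmono.continuousAt_iff_leftLim_eq_rightLim, StieltjesFunction.rightLim_eq]
  have h : (ProbabilityTheory.cdf μ).measure {a} = 0 := by
    rw [ProbabilityTheory.measure_cdf, measure_singleton]
  rw [StieltjesFunction.measure_singleton, ENNReal.ofReal_eq_zero] at h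
  exact le_antisymm (hmono.leftLim_le le_rfl) (by linarith)

/-- The distribution function of an atomless probability measure on `ℝ` takes the value `β`
at its lower `β`-quantile. -/
lemma cdf_sInf_eq_of_nullSingletonClass (μ : Measure ℝ) [IsProbabilityMeasure μ]
    [NullSingletonClass μ] {β : ℝ} (hβ : β ∈ Set.Ioo (0 : ℝ) 1) :
    ProbabilityTheory.cdf μ (sInf {α : ℝ | β ≤ ProbabilityTheory.cdf μ α}) = β := by
  have hcont := continuous_cdf_of_nullSingletonClass μ
  have hmono := ProbabilityTheory.monotone_cdf μ
  obtain ⟨a, ha⟩ :=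
    ((ProbabilityTheory.tendsto_cdf_atBot μ).eventually (gt_mem_nhds hβ.1)).exists
  obtain ⟨b, hb⟩ :=
    ((ProbabilityTheory.tendsto_cdf_atTop μ).eventually (lt_mem_nhds hβ.2)).exists
  obtain ⟨c, hc⟩ := mem_range_of_exists_le_of_exists_ge hcont ⟨a, ha.le⟩ ⟨b, hb.le⟩
  have hbdd : BddBelow {α : ℝ | β ≤ ProbabilityTheory.cdf μ α} :=
    ⟨a, fun x hx => (hmono.reflect_lt (ha.trans_le hx)).le⟩
  have hmem : sInf {α : ℝ | β ≤ ProbabilityTheory.cdf μ α} ∈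
      {α : ℝ | β ≤ ProbabilityTheory.cdf μ α} :=
    (isClosed_le continuous_const hcont).csInf_mem ⟨c, hc.ge⟩ hbdd
  exact le_antisymm ((hmono (csInf_le hbdd hc.ge)).trans_eq hc) hmem

/-- For an integrable function with atomless distribution, the probability of lying at or above
the lower `β`-quantile is `1 - β`. -/
lemma measureReal_sInf_le_of_atomless {Ω : Type*} [MeasurableSpace Ω]
    (P : Measure Ω) [IsProbabilityMeasure P] {L : Ω → ℝ} (hL : AEMeasurable L P)
    {β : ℝ} (hβ : β ∈ Set.Ioo (0 : ℝ) 1) (hAtomless : ∀ a : ℝ, P {ω | L ω = a} = 0) :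
    P.real {ω | sInf {α : ℝ | β ≤ (P {ω | L ω ≤ α}).toReal} ≤ L ω} = 1 - β := by
  have hmap {s : Set ℝ} (hs : MeasurableSet s) : (P.map L).real s = P.real (L ⁻¹' s) :=
    map_measureReal_apply_of_aemeasurable hL hs
  have : IsProbabilityMeasure (P.map L) := Measure.isProbabilityMeasure_map hL
  have : NullSingletonClass (P.map L) :=
    ⟨fun a => by
      rw [Measure.map_apply_of_aemeasurable hL (measurableSet_singleton a)]
      exact hAtomless a⟩
  have hcdf (α : ℝ) : (P {ω | L ω ≤ α}).toReal = ProbabilityTheory.cdf (P.map L) α := by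
    rw [ProbabilityTheory.cdf_eq_real, hmap measurableSet_Iic]
    rfl
  simp only [hcdf]
  have hq := cdf_sInf_eq_of_nullSingletonClass (P.map L) hβ
  set q := sInf {α : ℝ | β ≤ ProbabilityTheory.cdf (P.map L) α}
  rw [ProbabilityTheory.cdf_eq_real, ← measureReal_congr Iio_ae_eq_Iic] at hq
  have hcompl := probReal_compl_eq_one_sub (μ := P.map L) (measurableSet_Iio (a := q))
  rw [Set.compl_Iio, hq, hmap measurableSet_Ici] at hcompl
  exact hcompl

theorem min_cvar_objective_eq_cvar {Ω : Type*} [MeasurableSpace Ω]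
    (P : Measure Ω) [IsProbabilityMeasure P] (L : Ω → ℝ) (hL : Integrable L P)
    (β : ℝ) (hβ : β ∈ Set.Ioo (0 : ℝ) 1)
    (hAtomless : ∀ a : ℝ, P {ω | L ω = a} = 0)
    (αβ : ℝ) (hαβ : αβ = sInf {α : ℝ | β ≤ (P {ω | L ω ≤ α}).toReal})
    (Fβ : ℝ → ℝ)
    (hFβ : ∀ α : ℝ, Fβ α = α + (1 - β)⁻¹ * ∫ ω, max (L ω - α) 0 ∂P) :
    sInf (Set.range Fβ) = Fβ αβ ∧
      Fβ αβ = (1 - β)⁻¹ * ∫ ω in {ω | αβ ≤ L ω}, L ω ∂P := by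
  have htail : P.real {ω | αβ ≤ L ω} = 1 - β := by
    rw [hαβ]
    exact measureReal_sInf_le_of_atomless P hL.aemeasurable hβ hAtomless
  set A := {ω | αβ ≤ L ω}
  have hA : NullMeasurableSet A P := hL.aemeasurable.nullMeasurableSet_preimage measurableSet_Ici
  have hpos : 0 < 1 - β := by linarith [hβ.2]
  have hsub (α : ℝ) : Integrable (fun ω => L ω - α) P := hL.sub (integrable_const α)
  have hint (α : ℝ) : ∫ ω, A.indicator (fun ω => L ω - α) ω ∂P
      = ∫ ω in A, L ω ∂P - (1 - β) * α := by
    rw [integral_indicator₀ hA, integral_sub hL.integrableOn (integrable_const α).integrableOn,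
      setIntegral_const, htail, smul_eq_mul]
  have hlower (α : ℝ) : (1 - β)⁻¹ * ∫ ω in A, L ω ∂P ≤ Fβ α := by
    have hle : ∫ ω, A.indicator (fun ω => L ω - α) ω ∂P ≤ ∫ ω, max (L ω - α) 0 ∂P :=
      integral_mono ((hsub α).indicator₀ hA) (hsub α).pos_part fun ω =>
        Set.indicator_le' (fun _ _ => le_max_left _ _) (fun _ _ => le_max_right _ _) ω
    rw [hint] at hle
    have := mul_le_mul_of_nonneg_left hle (inv_pos.2 hpos).le
    rw [mul_sub, inv_mul_cancel_left₀ hpos.ne'] at this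
    rw [hFβ]
    linarith
  have hvalue : Fβ αβ = (1 - β)⁻¹ * ∫ ω in A, L ω ∂P := by
    have hmax : (fun ω => max (L ω - αβ) 0) = A.indicator (fun ω => L ω - αβ) := by
      ext ω
      by_cases h : αβ ≤ L ω
      · rw [Set.indicator_of_mem (show ω ∈ A from h), max_eq_left (sub_nonneg.2 h)]
      · rw [Set.indicator_of_notMem (show ω ∉ A from h),
          max_eq_right (sub_nonpos.2 (le_of_not_ge h))]
    rw [hFβ, hmax, hint, mul_sub, inv_mul_cancel_left₀ hpos.ne']
    ring
  refine ⟨IsLeast.csInf_eq ⟨⟨αβ, rfl⟩, ?_⟩, hvalue⟩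
  rintro _ ⟨α, rfl⟩
  exact hvalue.trans_le (hlower α)
end

section
/- Let P be a probability measure on a measurable space Ω, let L : Ω → ℝ be integrable with respect to P, let β ∈ (0,1), and assume the distribution of L is atomless, i.e., P({ω : L(ω) = a}) = 0 for every a ∈ ℝ. Let α_β := inf{α ∈ ℝ : P({ω : L(ω) ≤ α}) ≥ β}. Then the β-VaR never exceeds the β-CVaR: α_β ≤ (1−β)⁻¹ ∫_{{ω : L(ω) ≥ α_β}} L dP. -/
open MeasureTheory

open ProbabilityTheory Filter Topology in
/-- The distribution function of an atomless probability measure on `ℝ` takes the value `β` at its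
lower `β`-quantile. -/
lemma cdf_sInf_le_cdf_eq (ν : Measure ℝ) [IsProbabilityMeasure ν] [NullSingletonClass ν] {β : ℝ}
    (hβ : β ∈ Set.Ioo (0 : ℝ) 1) : cdf ν (sInf {x | β ≤ cdf ν x}) = β := by
  obtain ⟨b, hb⟩ := ((tendsto_cdf_atTop ν).eventually (lt_mem_nhds hβ.2)).exists
  obtain ⟨c, hc⟩ := ((tendsto_cdf_atBot ν).eventually (gt_mem_nhds hβ.1)).exists
  have hbdd : BddBelow {x | β ≤ cdf ν x} :=
    ⟨c, fun x hx ↦ le_of_lt ((monotone_cdf ν).reflect_lt (hc.trans_le hx))⟩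
  have hne : {x | β ≤ cdf ν x}.Nonempty := ⟨b, hb.le⟩
  set a := sInf {x | β ≤ cdf ν x}
  apply le_antisymm
  · have h := (cdf ν).measure_singleton a
    rw [measure_cdf, measure_singleton, eq_comm, ENNReal.ofReal_eq_zero, sub_nonpos] at h
    refine h.trans (le_of_tendsto ((monotone_cdf ν).tendsto_leftLim a) ?_)
    filter_upwards [self_mem_nhdsWithin] with x hx
    exact le_of_not_ge fun hx' ↦ notMem_of_lt_csInf hx hbdd hx'
  · have h : Tendsto (cdf ν) (𝓝[>] a) (𝓝 (cdf ν a)) :=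
      ((cdf ν).right_continuous a).mono_left (nhdsWithin_mono _ Set.Ioi_subset_Ici_self)
    refine ge_of_tendsto h ?_
    filter_upwards [self_mem_nhdsWithin] with x hx
    obtain ⟨y, hy, hyx⟩ := exists_lt_of_csInf_lt hne hx
    exact hy.trans (monotone_cdf ν hyx.le)

theorem var_le_cvar {Ω : Type*} [MeasurableSpace Ω]
    (P : Measure Ω) [IsProbabilityMeasure P] (L : Ω → ℝ) (hL : Integrable L P)
    (β : ℝ) (hβ : β ∈ Set.Ioo (0 : ℝ) 1)
    (hAtomless : ∀ a : ℝ, P {ω | L ω = a} = 0)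
    (αβ : ℝ) (hαβ : αβ = sInf {α : ℝ | β ≤ (P {ω | L ω ≤ α}).toReal}) :
    αβ ≤ (1 - β)⁻¹ * ∫ ω in {ω | αβ ≤ L ω}, L ω ∂P := by
  have hm : AEMeasurable L P := hL.aemeasurable
  have : IsProbabilityMeasure (P.map L) := Measure.isProbabilityMeasure_map hm
  have : NullSingletonClass (P.map L) :=
    ⟨fun a ↦ by rw [Measure.map_apply_of_aemeasurable hm (measurableSet_singleton a)]
                exact hAtomless a⟩
  have hcdf (x : ℝ) : (P {ω | L ω ≤ x}).toReal = ProbabilityTheory.cdf (P.map L) x := by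
    rw [ProbabilityTheory.cdf_eq_real, measureReal_def,
      Measure.map_apply_of_aemeasurable hm measurableSet_Iic]
    rfl
  have hquant : ProbabilityTheory.cdf (P.map L) αβ = β := by
    simp_rw [hαβ, hcdf]
    exact cdf_sInf_le_cdf_eq _ hβ
  have htail : P.real {ω | αβ ≤ L ω} = 1 - β := by
    have h : (P.map L).real (Set.Ici αβ) = 1 - β := by
      rw [← Set.compl_Iio, probReal_compl_eq_one_sub measurableSet_Iio,
        measureReal_congr Iio_ae_eq_Iic, ← ProbabilityTheory.cdf_eq_real, hquant]
    rwa [measureReal_def, Measure.map_apply_of_aemeasurable hm measurableSet_Ici] at h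
  have hint : (1 - β) * αβ ≤ ∫ ω in {ω | αβ ≤ L ω}, L ω ∂P := by
    have hs : NullMeasurableSet {ω | αβ ≤ L ω} P := hm.nullMeasurable measurableSet_Ici
    rw [← htail, ← smul_eq_mul, ← setIntegral_const]
    exact setIntegral_mono_on₀ (integrable_const _).integrableOn hL.integrableOn hs fun _ h ↦ h
  rwa [inv_mul_eq_div, le_div_iff₀' (sub_pos.2 hβ.2)]
end

section
/- Let Q be a real symmetric positive semidefinite n×n matrix, q ∈ ℝⁿ, s ∈ ℝ, A a real m×n matrix, and b ∈ ℝᵐ. Assume there exists λ₀ ∈ ℝⁿ with Aλ₀ < b componentwise. Then λᵀQλ + qᵀλ + s ≥ 0 for all λ with Aλ ≤ b if and only if there exists τ ∈ ℝᵐ with τ ≥ 0 such that the (n+1)×(n+1) block matrix [[Q, (q + Aᵀτ)/2], [(q + Aᵀτ)ᵀ/2, s − τᵀb]] is positive semidefinite. -/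
open Matrix

/-- Lagrangian strong duality for a finite system of convex inequalities under Slater's
condition, in its theorem-of-alternatives form. -/
theorem exists_lagrange_multipliers_of_slater {E ι : Type*} [AddCommGroup E] [Module ℝ E]
    [Fintype ι] {f : E → ℝ} {g : ι → E → ℝ} (hf : ConvexOn ℝ Set.univ f)
    (hg : ∀ i, ConvexOn ℝ Set.univ (g i)) (hslater : ∃ x, ∀ i, g i x < 0)
    (h : ∀ x, (∀ i, g i x ≤ 0) → 0 ≤ f x) :
    ∃ τ : ι → ℝ, 0 ≤ τ ∧ ∀ x, 0 ≤ f x + ∑ i, τ i * g i x := by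
  classical
  obtain ⟨x₀, hx₀⟩ := hslater
  set C : Set ((ι → ℝ) × ℝ) := {p | ∃ x, (∀ i, g i x < p.1 i) ∧ f x < p.2} with hC
  have hopen : IsOpen C := by
    simp only [hC, Set.ofPred_exists, Set.ofPred_and, Set.ofPred_forall]
    refine isOpen_iUnion fun x => IsOpen.inter (isOpen_iInter_of_finite fun i => ?_) ?_
    · exact isOpen_lt continuous_const (by fun_prop)
    · exact isOpen_lt continuous_const (by fun_prop)
  have hconv : Convex ℝ C := by
    refine convex_iff_forall_pos.2 ?_
    rintro p ⟨x, hx, hx'⟩ r ⟨y, hy, hy'⟩ α β hα hβ hαβ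
    refine ⟨α • x + β • y, fun i => ?_, ?_⟩
    · refine ((hg i).2 trivial trivial hα.le hβ.le hαβ).trans_lt ?_
      exact add_lt_add (mul_lt_mul_of_pos_left (hx i) hα) (mul_lt_mul_of_pos_left (hy i) hβ)
    · refine (hf.2 trivial trivial hα.le hβ.le hαβ).trans_lt ?_
      exact add_lt_add (mul_lt_mul_of_pos_left hx' hα) (mul_lt_mul_of_pos_left hy' hβ)
  have hzero : (0 : (ι → ℝ) × ℝ) ∉ C := by
    rintro ⟨x, hx, hx'⟩
    exact (h x fun i => (hx i).le).not_gt hx'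
  obtain ⟨φ, hφ⟩ := geometric_hahn_banach_point_open hconv hopen hzero
  simp only [map_zero] at hφ
  set μ : ι → ℝ := fun i => φ (Pi.single i 1, 0) with hμ
  set ρ : ℝ := φ (0, 1) with hρ
  have hrep (u : ι → ℝ) (t : ℝ) : φ (u, t) = ∑ i, μ i * u i + ρ * t := by
    have h₁ : (u, t) = ∑ i, u i • ((Pi.single i 1, 0) : (ι → ℝ) × ℝ) + t • (0, 1) := by
      ext j
      · simp [Prod.fst_sum, Finset.sum_apply, Pi.single_apply]
      · simp [Prod.snd_sum]
    rw [h₁, map_add, map_sum, map_smul]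
    simp only [map_smul, smul_eq_mul, hμ, hρ, mul_comm]
  have hpos (x : E) (u : ι → ℝ) (t : ℝ) (hu : ∀ i, g i x < u i) (ht : f x < t) :
      0 < ∑ i, μ i * u i + ρ * t := hrep u t ▸ hφ (u, t) ⟨x, hu, ht⟩
  have hρ_pos : 0 < ρ := by
    have h₁ := hpos x₀ 0 (|f x₀| + 1) hx₀ (by linarith [le_abs_self (f x₀)])
    simp only [Pi.zero_apply, mul_zero, Finset.sum_const_zero, zero_add] at h₁
    exact pos_of_mul_pos_left h₁ (by positivity)
  have hμ_nonneg (i : ι) : 0 ≤ μ i := by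
    by_contra! hneg
    set c : ℝ := ρ * (|f x₀| + 1) with hc
    have hc_pos : 0 < c := by positivity
    have hk : 0 ≤ c / (-μ i) := div_nonneg hc_pos.le (by linarith)
    have h₁ := hpos x₀ (Pi.single i (c / (-μ i))) (|f x₀| + 1)
      (fun j => (hx₀ j).trans_le ((Pi.single_nonneg.2 hk : (0 : ι → ℝ) ≤ _) j))
      (by linarith [le_abs_self (f x₀)])
    have h₂ : μ i * (c / (-μ i)) = -c := by rw [div_neg, mul_neg, mul_div_cancel_of_imp' fun h₃ => absurd h₃ hneg.ne]
    simp only [Pi.single_apply, mul_ite, mul_zero, Finset.sum_ite_eq', Finset.mem_univ,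
      if_true, h₂, ← hc] at h₁
    linarith
  have hlim (x : E) : 0 ≤ ∑ i, μ i * g i x + ρ * f x := by
    have hS : 0 ≤ ∑ i, μ i := Finset.sum_nonneg fun i _ => hμ_nonneg i
    refine le_of_forall_pos_le_add fun ε hε => ?_
    have hδ : 0 < ε / (∑ i, μ i + ρ) := by positivity
    have h₁ := hpos x (fun i => g i x + ε / (∑ i, μ i + ρ)) (f x + ε / (∑ i, μ i + ρ))
      (fun i => by linarith) (by linarith)
    simp only [mul_add, Finset.sum_add_distrib, ← Finset.sum_mul] at h₁
    have h₂ : (∑ i, μ i) * (ε / (∑ i, μ i + ρ)) + ρ * (ε / (∑ i, μ i + ρ)) = ε := by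
      field_simp
    linarith
  refine ⟨fun i => μ i / ρ, fun i => div_nonneg (hμ_nonneg i) hρ_pos.le, fun x => ?_⟩
  have h₁ : f x + ∑ i, μ i / ρ * g i x = (∑ i, μ i * g i x + ρ * f x) / ρ := by
    rw [add_div, Finset.sum_div, mul_div_cancel_left₀ _ hρ_pos.ne', add_comm]
    simp only [div_mul_eq_mul_div]
  rw [h₁]
  exact div_nonneg (hlim x) hρ_pos.le

/-- The quadratic form of a positive semidefinite real matrix is convex. -/
theorem Matrix.PosSemidef.convexOn_dotProduct_mulVec {ι : Type*} [Fintype ι]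
    {Q : Matrix ι ι ℝ} (hQ : Q.PosSemidef) :
    ConvexOn ℝ Set.univ fun x : ι → ℝ => x ⬝ᵥ Q *ᵥ x := by
  refine ⟨convex_univ, fun x _ y _ α β hα hβ hαβ => ?_⟩
  have h₁ : 0 ≤ (x - y) ⬝ᵥ Q *ᵥ (x - y) := by simpa using hQ.dotProduct_mulVec_nonneg (x - y)
  have h₂ := mul_nonneg (mul_nonneg hα hβ) h₁
  obtain rfl : β = 1 - α := by linarith
  simp only [mulVec_add, mulVec_sub, mulVec_smul, dotProduct_add, dotProduct_sub, add_dotProduct,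
    sub_dotProduct, smul_dotProduct, dotProduct_smul, smul_eq_mul] at h₂ ⊢
  linarith

/-- Homogenization: a quadratic polynomial with positive semidefinite leading part is nonnegative
everywhere if and only if its bordered coefficient matrix is positive semidefinite. -/
theorem Matrix.PosSemidef.fromBlocks_half_iff {ι : Type*} [Fintype ι]
    {Q : Matrix ι ι ℝ} (hQ : Q.PosSemidef) (c : ι → ℝ) (d : ℝ) :
    (fromBlocks Q (of fun i (_ : Unit) => c i / 2) (of fun (_ : Unit) j => c j / 2)
      (of fun (_ : Unit) (_ : Unit) => d)).PosSemidef ↔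
      ∀ x : ι → ℝ, 0 ≤ x ⬝ᵥ Q *ᵥ x + c ⬝ᵥ x + d := by
  have hform (x : ι → ℝ) (t : ℝ) :
      Sum.elim x (fun _ : Unit => t) ⬝ᵥ
        fromBlocks Q (of fun i (_ : Unit) => c i / 2) (of fun (_ : Unit) j => c j / 2)
          (of fun (_ : Unit) (_ : Unit) => d) *ᵥ Sum.elim x (fun _ => t) =
        x ⬝ᵥ Q *ᵥ x + t * (c ⬝ᵥ x) + t ^ 2 * d := by
    have h₁ : (of fun i (_ : Unit) => c i / 2) *ᵥ (fun _ : Unit => t) = (t / 2) • c := by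
      ext i
      simp [mulVec, dotProduct]
      ring
    have h₂ : (of fun (_ : Unit) j => c j / 2) *ᵥ x = fun _ => c ⬝ᵥ x / 2 := by
      ext i
      simp only [mulVec, dotProduct, of_apply, Finset.sum_div, div_mul_eq_mul_div]
    have h₃ : (of fun (_ : Unit) (_ : Unit) => d) *ᵥ (fun _ : Unit => t) = fun _ => d * t := by
      ext i
      simp [mulVec, dotProduct]
    rw [fromBlocks_mulVec, Sum.elim_comp_inl, Sum.elim_comp_inr, h₁, h₂, h₃,
      sumElim_dotProduct_sumElim, dotProduct_add, dotProduct_smul, dotProduct_comm x c]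
    simp [dotProduct]
    ring
  rw [posSemidef_iff_dotProduct_mulVec]
  constructor
  · rintro ⟨-, h⟩ x
    have h₁ := h (Sum.elim x fun _ => 1)
    rw [star_trivial, hform] at h₁
    simpa using h₁
  · intro h
    refine ⟨IsHermitian.fromBlocks hQ.isHermitian (by ext; simp) (by ext; simp), fun z => ?_⟩
    obtain ⟨x, t, rfl⟩ : ∃ (x : ι → ℝ) (t : ℝ), z = Sum.elim x fun _ => t :=
      ⟨z ∘ Sum.inl, z (Sum.inr ()), by ext (i | i) <;> rfl⟩
    rw [star_trivial, hform]
    rcases eq_or_ne t 0 with rfl | ht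
    · simpa using hQ.dotProduct_mulVec_nonneg x
    · have h₁ := mul_nonneg (sq_nonneg t) (h (t⁻¹ • x))
      simp only [mulVec_smul, dotProduct_smul, smul_dotProduct, smul_eq_mul] at h₁
      field_simp at h₁
      linarith

theorem robust_quadratic_iff_lmi (n m : ℕ)
    (Q : Matrix (Fin n) (Fin n) ℝ) (hQsymm : Q.IsSymm) (hQpsd : Q.PosSemidef)
    (q : Fin n → ℝ) (s : ℝ)
    (A : Matrix (Fin m) (Fin n) ℝ) (b : Fin m → ℝ)
    (hSlater : ∃ lam₀ : Fin n → ℝ, ∀ i, A.mulVec lam₀ i < b i) :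
    (∀ lam : Fin n → ℝ, A.mulVec lam ≤ b →
        0 ≤ lam ⬝ᵥ Q.mulVec lam + q ⬝ᵥ lam + s) ↔
      ∃ τ : Fin m → ℝ, 0 ≤ τ ∧
        (Matrix.fromBlocks Q
            (Matrix.of fun i (_ : Unit) => (q i + Aᵀ.mulVec τ i) / 2)
            (Matrix.of fun (_ : Unit) j => (q j + Aᵀ.mulVec τ j) / 2)
            (Matrix.of fun (_ : Unit) (_ : Unit) => s - τ ⬝ᵥ b)).PosSemidef := by
  have hlagr (τ : Fin m → ℝ) (x : Fin n → ℝ) :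
      x ⬝ᵥ Q *ᵥ x + (q + Aᵀ *ᵥ τ) ⬝ᵥ x + (s - τ ⬝ᵥ b) =
        x ⬝ᵥ Q *ᵥ x + q ⬝ᵥ x + s + τ ⬝ᵥ (A *ᵥ x - b) := by
    rw [add_dotProduct, mulVec_transpose, ← dotProduct_mulVec, dotProduct_sub]
    ring
  have hlmi (τ : Fin m → ℝ) := hQpsd.fromBlocks_half_iff (q + Aᵀ *ᵥ τ) (s - τ ⬝ᵥ b)
  simp only [hlagr, Pi.add_apply] at hlmi
  simp only [hlmi]
  constructor
  · intro h
    refine exists_lagrange_multipliers_of_slater (g := fun i x => (A *ᵥ x - b) i) ?_ (fun i => ?_)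
      ?_ fun x hx => h x fun i => sub_nonpos.1 (hx i)
    · refine (hQpsd.convexOn_dotProduct_mulVec.add ?_).add (convexOn_const s convex_univ)
      exact (dotProductBilin ℝ ℝ q).convexOn convex_univ
    · exact (((LinearMap.proj i).comp A.mulVecLin).convexOn convex_univ).sub
        (concaveOn_const (b i) convex_univ)
    · exact hSlater.imp fun x hx i => sub_neg.2 (hx i)
  · rintro ⟨τ, hτ, h⟩ x hx
    have h₁ : 0 ≤ τ ⬝ᵥ (b - A *ᵥ x) := dotProduct_nonneg_of_nonneg hτ (sub_nonneg.2 hx)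
    have h₂ := h x
    rw [← neg_sub b, dotProduct_neg] at h₂
    linarith
end

section
/- Let Σ be a real symmetric positive definite n×n matrix with positive semidefinite square root Σ^{1/2}, μ ∈ ℝⁿ, γ₁, γ₂ ≥ 0, and let S ⊆ ℝⁿ be a measurable set. Let P be a probability measure on ℝⁿ with P(S) = 1 and ∫ ‖λ‖² dP < ∞ such that its mean m = ∫ λ dP satisfies (m − μ)ᵀΣ⁻¹(m − μ) ≤ γ₁ and its centered second moment satisfies ∫ (λ − μ)(λ − μ)ᵀ dP ⪯ γ₂Σ (where A ⪯ B means B − A is positive semidefinite). Let h : ℝⁿ → ℝ be P-integrable, let Q be a real symmetric positive semidefinite n×n matrix, q ∈ ℝⁿ, and r, t ∈ ℝ such that: (i) h(λ) ≤ λᵀQλ + qᵀλ + r for all λ ∈ S, and (ii) t ≥ tr((γ₂Σ + μμᵀ)Q) + μᵀq + √γ₁ ‖Σ^{1/2}(q + 2Qμ)‖₂. Then ∫ h dP ≤ r + t. -/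
open Matrix MeasureTheory

lemma Matrix.PosSemidef.trace_mul_nonneg_real {n : ℕ} {A B : Matrix (Fin n) (Fin n) ℝ}
    (hA : A.PosSemidef) (hB : B.PosSemidef) : 0 ≤ (A * B).trace := by
  obtain ⟨L, rfl⟩ : ∃ L : Matrix (Fin n) (Fin n) ℝ, B = Lᴴ * L := by
    open scoped MatrixOrder in
    exact CStarAlgebra.nonneg_iff_eq_star_mul_self.mp hB.nonneg
  rw [← Matrix.mul_assoc, Matrix.trace_mul_comm, ← Matrix.mul_assoc]
  exact (hA.mul_mul_conjTranspose_same L).trace_nonneg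

lemma dotProduct_le_sqrt_mul_sqrt_of_sq {n : ℕ} {A R : Matrix (Fin n) (Fin n) ℝ} (hA : A.PosDef)
    (hR : R.PosSemidef) (hRR : R * R = A) {c : ℝ} {d : Fin n → ℝ}
    (hd : d ⬝ᵥ A⁻¹.mulVec d ≤ c) (w : Fin n → ℝ) :
    w ⬝ᵥ d ≤ √c * √(∑ i, (R.mulVec w i) ^ 2) := by
  have hRT : Rᵀ = R := by simpa using hR.isHermitian.eq
  have hdet : IsUnit R.det := by
    have : IsUnit (R * R).det := by rw [hRR]; exact hA.det_pos.ne'.isUnit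
    rw [Matrix.det_mul] at this
    exact isUnit_of_mul_isUnit_left this
  set z := R⁻¹.mulVec d with hz
  have hdz : d = R.mulVec z := by
    rw [hz, Matrix.mulVec_mulVec, Matrix.mul_nonsing_inv _ hdet, Matrix.one_mulVec]
  have hwd : w ⬝ᵥ d = ∑ i, z i * R.mulVec w i := by
    rw [hdz, Matrix.dotProduct_mulVec, ← Matrix.mulVec_transpose, hRT, dotProduct_comm]
    rfl
  have hzz : ∑ i, z i ^ 2 ≤ c := by
    refine le_trans (le_of_eq ?_) hd
    rw [← hRR, Matrix.mul_inv_rev, ← Matrix.mulVec_mulVec, Matrix.dotProduct_mulVec,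
      ← Matrix.mulVec_transpose, Matrix.transpose_nonsing_inv, hRT, ← hz]
    simp [dotProduct, sq]
  rw [hwd]
  refine (Real.sum_mul_le_sqrt_mul_sqrt _ _ _).trans ?_
  gcongr

lemma integrable_apply_mul_apply {n : ℕ} {P : Measure (Fin n → ℝ)}
    (hmom : Integrable (fun lam => ‖lam‖ ^ 2) P) (i j : Fin n) :
    Integrable (fun lam : Fin n → ℝ => lam i * lam j) P := by
  refine hmom.mono' (by fun_prop) (.of_forall fun x => ?_)
  rw [norm_mul, sq]
  gcongr <;> exact norm_le_pi_norm x _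

lemma integrable_apply {n : ℕ} {P : Measure (Fin n → ℝ)} [IsFiniteMeasure P]
    (hmom : Integrable (fun lam => ‖lam‖ ^ 2) P) (i : Fin n) :
    Integrable (fun lam : Fin n → ℝ => lam i) P := by
  refine (hmom.add (integrable_const 1)).mono' (measurable_pi_apply i).aestronglyMeasurable
    (.of_forall fun x => ?_)
  have := norm_le_pi_norm x i
  simp only [Pi.add_apply]
  nlinarith [sq_nonneg (‖x‖ - 1), sq_nonneg ‖x‖]

lemma Matrix.IsSymm.dotProduct_mulVec_add_eq {n : ℕ} {Q : Matrix (Fin n) (Fin n) ℝ}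
    (hQ : Q.IsSymm) (μ q x : Fin n → ℝ) :
    x ⬝ᵥ Q.mulVec x + q ⬝ᵥ x = (x - μ) ⬝ᵥ Q.mulVec (x - μ) +
      (q + 2 • Q.mulVec μ) ⬝ᵥ (x - μ) + μ ⬝ᵥ q + μ ⬝ᵥ Q.mulVec μ := by
  have hs : μ ⬝ᵥ Q.mulVec x = x ⬝ᵥ Q.mulVec μ := by
    rw [Matrix.dotProduct_mulVec, ← Matrix.mulVec_transpose, hQ.eq, dotProduct_comm]
  simp only [Matrix.mulVec_sub, sub_dotProduct, dotProduct_sub, add_dotProduct, two_nsmul,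
    hs, dotProduct_comm (Q.mulVec μ), dotProduct_comm q μ]
  ring

lemma dotProduct_mulVec_eq_sum {n : ℕ} (Q : Matrix (Fin n) (Fin n) ℝ) (x : Fin n → ℝ) :
    x ⬝ᵥ Q.mulVec x = ∑ i, ∑ j, Q j i * (x i * x j) := by
  rw [Finset.sum_comm]
  simp only [dotProduct, Matrix.mulVec, Finset.mul_sum]
  exact Finset.sum_congr rfl fun i _ => Finset.sum_congr rfl fun j _ => by ring

theorem dro_weak_duality (n : ℕ)
    (Sig : Matrix (Fin n) (Fin n) ℝ) (hSig : Sig.PosDef)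
    (R : Matrix (Fin n) (Fin n) ℝ) (hR : R.PosSemidef) (hRR : R * R = Sig)
    (μ : Fin n → ℝ) (γ₁ γ₂ : ℝ) (hγ₁ : 0 ≤ γ₁) (hγ₂ : 0 ≤ γ₂)
    (S : Set (Fin n → ℝ)) (hSmeas : MeasurableSet S)
    (P : Measure (Fin n → ℝ)) [IsProbabilityMeasure P] (hPS : P S = 1)
    (hmom : Integrable (fun lam => ‖lam‖ ^ 2) P)
    (m : Fin n → ℝ) (hm : ∀ i, m i = ∫ lam, lam i ∂P)
    (hmean : (m - μ) ⬝ᵥ Sig⁻¹.mulVec (m - μ) ≤ γ₁)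
    (C : Matrix (Fin n) (Fin n) ℝ)
    (hC : ∀ i j, C i j = ∫ lam, (lam i - μ i) * (lam j - μ j) ∂P)
    (hcov : (γ₂ • Sig - C).PosSemidef)
    (h : (Fin n → ℝ) → ℝ) (hh : Integrable h P)
    (Q : Matrix (Fin n) (Fin n) ℝ) (hQsymm : Q.IsSymm) (hQpsd : Q.PosSemidef)
    (q : Fin n → ℝ) (r t : ℝ)
    (hmaj : ∀ lam ∈ S, h lam ≤ lam ⬝ᵥ Q.mulVec lam + q ⬝ᵥ lam + r)
    (ht : ((γ₂ • Sig + Matrix.of fun i j => μ i * μ j) * Q).trace + μ ⬝ᵥ q +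
        Real.sqrt γ₁ * Real.sqrt (∑ i, (R.mulVec (q + 2 • Q.mulVec μ) i) ^ 2) ≤ t) :
    ∫ lam, h lam ∂P ≤ r + t := by
  set w := q + 2 • Q.mulVec μ
  have hi := integrable_apply hmom
  have hij : ∀ i j, Integrable (fun x : Fin n → ℝ => (x i - μ i) * (x j - μ j)) P := by
    intro i j
    have := (((integrable_apply_mul_apply hmom i j).sub ((hi i).mul_const (μ j))).sub
      ((hi j).const_mul (μ i))).add (integrable_const (μ i * μ j))
    refine this.congr (.of_forall fun x => ?_)
    simp only [Pi.add_apply, Pi.sub_apply]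
    ring
  have hquadi : Integrable (fun x : Fin n → ℝ => (x - μ) ⬝ᵥ Q.mulVec (x - μ)) P := by
    simp only [dotProduct_mulVec_eq_sum, Pi.sub_apply]
    exact integrable_finsetSum _ fun i _ => integrable_finsetSum _ fun j _ =>
      (hij i j).const_mul _
  have hquad : ∫ x, (x - μ) ⬝ᵥ Q.mulVec (x - μ) ∂P = (C * Q).trace := by
    simp only [dotProduct_mulVec_eq_sum, Pi.sub_apply]
    rw [integral_finsetSum _ fun i _ => integrable_finsetSum _ fun j _ => (hij i j).const_mul _]
    simp only [Matrix.trace, Matrix.diag, Matrix.mul_apply]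
    refine Finset.sum_congr rfl fun i _ => ?_
    rw [integral_finsetSum _ fun j _ => (hij i j).const_mul _]
    refine Finset.sum_congr rfl fun j _ => ?_
    rw [integral_const_mul, hC, mul_comm]
  have hsub : ∀ i, Integrable (fun x : Fin n → ℝ => w i * (x i - μ i)) P :=
    fun i => ((hi i).sub (integrable_const _)).const_mul _
  have hlini : Integrable (fun x : Fin n → ℝ => w ⬝ᵥ (x - μ)) P := by
    simp only [dotProduct, Pi.sub_apply]
    exact integrable_finsetSum _ fun i _ => hsub i
  have hlin : ∫ x, w ⬝ᵥ (x - μ) ∂P = w ⬝ᵥ (m - μ) := by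
    simp only [dotProduct, Pi.sub_apply]
    rw [integral_finsetSum _ fun i _ => hsub i]
    refine Finset.sum_congr rfl fun i _ => ?_
    rw [integral_const_mul, integral_sub (hi i) (integrable_const _), hm]
    simp
  have hsum : Integrable (fun x : Fin n → ℝ =>
      (x - μ) ⬝ᵥ Q.mulVec (x - μ) + w ⬝ᵥ (x - μ)) P := hquadi.add hlini
  have hle : ∫ x, h x ∂P ≤
      ∫ x, ((x - μ) ⬝ᵥ Q.mulVec (x - μ) + w ⬝ᵥ (x - μ) + (μ ⬝ᵥ q + μ ⬝ᵥ Q.mulVec μ + r)) ∂P := by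
    refine integral_mono_ae hh (hsum.add (integrable_const _)) ?_
    filter_upwards [(mem_ae_iff_prob_eq_one hSmeas).mpr hPS] with x hx
    have := hmaj x hx
    rw [hQsymm.dotProduct_mulVec_add_eq μ q x] at this
    linarith
  rw [integral_add hsum (integrable_const _), integral_add hquadi hlini,
    hquad, hlin, integral_const, probReal_univ, one_smul] at hle
  have hCS := dotProduct_le_sqrt_mul_sqrt_of_sq hSig hR hRR hmean w
  have htr := hcov.trace_mul_nonneg_real hQpsd
  have hμ : ((Matrix.of fun i j => μ i * μ j) * Q).trace = μ ⬝ᵥ Q.mulVec μ := by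
    rw [dotProduct_mulVec_eq_sum]
    simp only [Matrix.trace, Matrix.diag, Matrix.mul_apply, Matrix.of_apply, mul_comm (Q _ _)]
  rw [Matrix.sub_mul, Matrix.trace_sub] at htr
  rw [Matrix.add_mul, Matrix.trace_add, hμ] at ht
  linarith
end
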